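/- arXiv:1702.05922 — 7 statements merged into one kernel-verified Lean document; each statement's English description precedes it below -/
import Mathlib

section
/- Let Ω ⊂ ℝ² be an open set, u : Ω → ℝ² and φ : Ω → ℝ smooth (C^∞) functions such that 2𝔼(u) + Dφ ⊗ Dφ = 0 at every point of Ω, where 𝔼(u) = (Du + Duᵀ)/2 is the symmetrized gradient of u and Dφ ⊗ Dφ is the matrix with entries ∂ᵢφ·∂ⱼφ. Then the determinant of the Hessian matrix of φ vanishes identically on Ω: det D²φ = 0 on Ω. -/
/-- Partial derivative in the first coordinate direction. -/
noncomputable def pd1 (f : ℝ × ℝ → ℝ) (x : ℝ × ℝ) : ℝ := fderiv ℝ f x (1, 0)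

/-- Partial derivative in the second coordinate direction. -/
noncomputable def pd2 (f : ℝ × ℝ → ℝ) (x : ℝ × ℝ) : ℝ := fderiv ℝ f x (0, 1)

open scoped ContDiff

/-- The directional derivative of a real function on the plane. -/
noncomputable def dirDeriv (v : ℝ × ℝ) (f : ℝ × ℝ → ℝ) (x : ℝ × ℝ) : ℝ := fderiv ℝ f x v

section dirDeriv

variable {Ω : Set (ℝ × ℝ)} {f g : ℝ × ℝ → ℝ}

theorem ContDiffOn.dirDeriv (hf : ContDiffOn ℝ ∞ f Ω) (hΩ : IsOpen Ω) (v : ℝ × ℝ) :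
    ContDiffOn ℝ ∞ (dirDeriv v f) Ω :=
  (hf.fderiv_of_isOpen hΩ (m := ∞) (by simp)).clm_apply contDiffOn_const

theorem ContDiffOn.differentiableAt_of_isOpen (hf : ContDiffOn ℝ ∞ f Ω) (hΩ : IsOpen Ω)
    {x : ℝ × ℝ} (hx : x ∈ Ω) : DifferentiableAt ℝ f x :=
  (hf.contDiffAt (hΩ.mem_nhds hx)).differentiableAt (by simp)

theorem Set.EqOn.dirDeriv (h : Set.EqOn f g Ω) (hΩ : IsOpen Ω) (v : ℝ × ℝ) :
    Set.EqOn (dirDeriv v f) (dirDeriv v g) Ω := fun x hx => by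
  simp only [_root_.dirDeriv, (h.eventuallyEq_of_mem (hΩ.mem_nhds hx)).fderiv_eq]

theorem eqOn_dirDeriv_add (hf : ContDiffOn ℝ ∞ f Ω) (hg : ContDiffOn ℝ ∞ g Ω) (hΩ : IsOpen Ω)
    (v : ℝ × ℝ) :
    Set.EqOn (dirDeriv v (f + g)) (dirDeriv v f + dirDeriv v g) Ω := fun x hx => by
  simp [dirDeriv, fderiv_add (hf.differentiableAt_of_isOpen hΩ hx)
    (hg.differentiableAt_of_isOpen hΩ hx)]

theorem eqOn_dirDeriv_mul (hf : ContDiffOn ℝ ∞ f Ω) (hg : ContDiffOn ℝ ∞ g Ω) (hΩ : IsOpen Ω)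
    (v : ℝ × ℝ) :
    Set.EqOn (dirDeriv v (f * g)) (f * dirDeriv v g + g * dirDeriv v f) Ω := fun x hx => by
  simp [dirDeriv, fderiv_mul (hf.differentiableAt_of_isOpen hΩ hx)
    (hg.differentiableAt_of_isOpen hΩ hx)]

theorem dirDeriv_const_smul (c : ℝ) (f : ℝ × ℝ → ℝ) (v : ℝ × ℝ) :
    dirDeriv v (c • f) = c • dirDeriv v f := by
  ext x
  simp [dirDeriv, fderiv_const_smul_field]

theorem eqOn_dirDeriv_comm (hf : ContDiffOn ℝ ∞ f Ω) (hΩ : IsOpen Ω) (v w : ℝ × ℝ) :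
    Set.EqOn (dirDeriv v (dirDeriv w f)) (dirDeriv w (dirDeriv v f)) Ω := fun x hx => by
  have hd : DifferentiableAt ℝ (fderiv ℝ f) x :=
    ((hf.fderiv_of_isOpen hΩ (m := ∞) (by simp)).contDiffAt (hΩ.mem_nhds hx)).differentiableAt
      (by simp)
  have key (v w : ℝ × ℝ) : dirDeriv v (dirDeriv w f) x = fderiv ℝ (fderiv ℝ f) x v w := by
    change fderiv ℝ (fun y => fderiv ℝ f y w) x v = _
    simp [fderiv_clm_apply hd (differentiableAt_const w)]
  rw [key, key]
  exact (hf.contDiffAt (hΩ.mem_nhds hx)).isSymmSndFDerivAt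
    (by rw [minSmoothness_of_isRCLikeNormedField]; exact WithTop.coe_le_coe.2 (le_top : (2 : ℕ∞) ≤ ⊤)) v w

/-- Second directional derivatives of a product. -/
theorem dirDeriv_dirDeriv_mul (hf : ContDiffOn ℝ ∞ f Ω) (hg : ContDiffOn ℝ ∞ g Ω)
    (hΩ : IsOpen Ω) (v w : ℝ × ℝ) {x : ℝ × ℝ} (hx : x ∈ Ω) :
    dirDeriv v (dirDeriv w (f * g)) x =
      f x * dirDeriv v (dirDeriv w g) x + dirDeriv w g x * dirDeriv v f x +
        (g x * dirDeriv v (dirDeriv w f) x + dirDeriv w f x * dirDeriv v g x) := by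
  have hf' := hf.dirDeriv hΩ w
  have hg' := hg.dirDeriv hΩ w
  have h₁ : ContDiffOn ℝ ∞ (f * dirDeriv w g) Ω := hf.mul hg'
  have h₂ : ContDiffOn ℝ ∞ (g * dirDeriv w f) Ω := hg.mul hf'
  rw [(eqOn_dirDeriv_mul hf hg hΩ w).dirDeriv hΩ v hx,
    eqOn_dirDeriv_add h₁ h₂ hΩ v hx, Pi.add_apply,
    eqOn_dirDeriv_mul hf hg' hΩ v hx, eqOn_dirDeriv_mul hg hf' hΩ v hx]
  simp

end dirDeriv

theorem stmt2 (Ω : Set (ℝ × ℝ)) (hΩ : IsOpen Ω)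
    (u1 u2 φ : ℝ × ℝ → ℝ)
    (hu1 : ContDiffOn ℝ (⊤ : ℕ∞) u1 Ω) (hu2 : ContDiffOn ℝ (⊤ : ℕ∞) u2 Ω)
    (hφ : ContDiffOn ℝ (⊤ : ℕ∞) φ Ω)
    -- 2𝔼(u) + Dφ ⊗ Dφ = 0 on Ω
    (heq : ∀ x ∈ Ω,
      (!![2 * pd1 u1 x + pd1 φ x * pd1 φ x,
          (pd2 u1 x + pd1 u2 x) + pd1 φ x * pd2 φ x;
          (pd1 u2 x + pd2 u1 x) + pd2 φ x * pd1 φ x,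
          2 * pd2 u2 x + pd2 φ x * pd2 φ x] : Matrix (Fin 2) (Fin 2) ℝ) = 0) :
    -- det D²φ = 0 on Ω
    ∀ x ∈ Ω,
      (!![pd1 (pd1 φ) x, pd2 (pd1 φ) x;
          pd1 (pd2 φ) x, pd2 (pd2 φ) x] : Matrix (Fin 2) (Fin 2) ℝ).det = 0 := by
  intro x hx
  set e : ℝ × ℝ := (1, 0)
  set e' : ℝ × ℝ := (0, 1)
  have ha := hφ.dirDeriv hΩ e
  have hb := hφ.dirDeriv hΩ e'
  have h11 : Set.EqOn (dirDeriv e φ * dirDeriv e φ) ((-2 : ℝ) • dirDeriv e u1) Ω := fun y hy => by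
    have h : 2 * dirDeriv e u1 y + dirDeriv e φ y * dirDeriv e φ y = 0 :=
      congrFun (congrFun (heq y hy) 0) 0
    simp only [Pi.mul_apply, Pi.smul_apply, smul_eq_mul]
    linarith
  have h12 : Set.EqOn (dirDeriv e φ * dirDeriv e' φ)
      ((-1 : ℝ) • (dirDeriv e' u1 + dirDeriv e u2)) Ω := fun y hy => by
    have h : dirDeriv e' u1 y + dirDeriv e u2 y + dirDeriv e φ y * dirDeriv e' φ y = 0 :=
      congrFun (congrFun (heq y hy) 0) 1
    simp only [Pi.mul_apply, Pi.smul_apply, Pi.add_apply, smul_eq_mul]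
    linarith
  have h22 : Set.EqOn (dirDeriv e' φ * dirDeriv e' φ) ((-2 : ℝ) • dirDeriv e' u2) Ω :=
    fun y hy => by
      have h : 2 * dirDeriv e' u2 y + dirDeriv e' φ y * dirDeriv e' φ y = 0 :=
        congrFun (congrFun (heq y hy) 1) 1
      simp only [Pi.mul_apply, Pi.smul_apply, smul_eq_mul]
      linarith
  have k11 := (h11.dirDeriv hΩ e').dirDeriv hΩ e' hx
  have k12 := (h12.dirDeriv hΩ e').dirDeriv hΩ e hx
  have k22 := (h22.dirDeriv hΩ e).dirDeriv hΩ e hx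
  rw [dirDeriv_dirDeriv_mul ha ha hΩ _ _ hx] at k11
  rw [dirDeriv_dirDeriv_mul ha hb hΩ _ _ hx] at k12
  rw [dirDeriv_dirDeriv_mul hb hb hΩ _ _ hx] at k22
  simp only [dirDeriv_const_smul, Pi.smul_apply, smul_eq_mul] at k11 k12 k22
  have hu1' := hu1.dirDeriv hΩ e'
  have hu2' := hu2.dirDeriv hΩ e
  rw [(eqOn_dirDeriv_add hu1' hu2' hΩ e').dirDeriv hΩ e hx,
    eqOn_dirDeriv_add (hu1'.dirDeriv hΩ e') (hu2'.dirDeriv hΩ e') hΩ e hx, Pi.add_apply,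
    eqOn_dirDeriv_comm hu1' hΩ e e' hx, (eqOn_dirDeriv_comm hu1 hΩ e e').dirDeriv hΩ e' hx,
    (eqOn_dirDeriv_comm hu2 hΩ e' e).dirDeriv hΩ e hx] at k12
  have c := eqOn_dirDeriv_comm hφ hΩ e e' hx
  have c1 := (eqOn_dirDeriv_comm hφ hΩ e e').dirDeriv hΩ e hx
  have c2 := (eqOn_dirDeriv_comm hφ hΩ e e').dirDeriv hΩ e' hx
  have c3 := eqOn_dirDeriv_comm hb hΩ e e' hx
  rw [Matrix.det_fin_two_of]
  change dirDeriv e (dirDeriv e φ) x * dirDeriv e' (dirDeriv e' φ) x -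
    dirDeriv e' (dirDeriv e φ) x * dirDeriv e (dirDeriv e' φ) x = 0
  rw [c1, c] at k22
  rw [c3, c2, c] at k12
  rw [c]
  linear_combination k12 - k11 / 2 - k22 / 2
end

section
/- Let ν ∈ (−1, 1/2) and let A be a real symmetric 2×2 matrix with eigenvalues λ₁ ≤ λ₂. Then the minimum over ξ ∈ ℝ² of g_A(ξ) = |A + ξ⊗ξ|² + (ν/(1−ν))·(Tr A + |ξ|²)² is attained, and its value equals g_A(0) = |A|² + (ν/(1−ν))·(Tr A)² if ν·λ₂ + λ₁ ≥ 0, while it equals (1+ν)·λ₂² if ν·λ₂ + λ₁ < 0. -/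
/-- Squared Frobenius norm. -/
noncomputable def frobSq (A : Matrix (Fin 2) (Fin 2) ℝ) : ℝ :=
  ∑ i, ∑ j, (A i j) ^ 2

/-- g_A(ξ) = |A + ξ⊗ξ|² + (ν/(1−ν))·(Tr A + |ξ|²)². -/
noncomputable def gA (ν : ℝ) (A : Matrix (Fin 2) (Fin 2) ℝ) (ξ : Fin 2 → ℝ) : ℝ :=
  frobSq (A + Matrix.of fun i j => ξ i * ξ j)
    + ν / (1 - ν) * (Matrix.trace A + (ξ 0 ^ 2 + ξ 1 ^ 2)) ^ 2

/-- A singular binary quadratic form with nonnegative diagonal is nonnegative. -/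
theorem degenerate_form_nonneg {p q b : ℝ} (hp : 0 ≤ p) (hq : 0 ≤ q) (hpq : p * q = b ^ 2)
    (x y : ℝ) : 0 ≤ p * x ^ 2 + 2 * b * (x * y) + q * y ^ 2 := by
  rcases hq.eq_or_lt with rfl | hq
  · have hb : b = 0 := by
      rw [mul_zero] at hpq
      exact pow_eq_zero_iff two_ne_zero |>.1 hpq.symm
    subst hb
    have := mul_nonneg hp (sq_nonneg x)
    linarith
  · refine nonneg_of_mul_nonneg_right ?_ hq
    have : q * (p * x ^ 2 + 2 * b * (x * y) + q * y ^ 2) = (b * x + q * y) ^ 2 := by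
      linear_combination x ^ 2 * hpq
    rw [this]
    positivity

/-- A singular binary quadratic form vanishes at some vector of any prescribed length. -/
theorem exists_isotropic_of_degenerate {p q b r : ℝ} (hpq : p * q = b ^ 2) (hr : 0 ≤ r) :
    ∃ x y : ℝ, x ^ 2 + y ^ 2 = r ∧ p * x ^ 2 + 2 * b * (x * y) + q * y ^ 2 = 0 := by
  by_cases hq : q = 0
  · subst hq
    exact ⟨0, √r, by simp [Real.sq_sqrt hr], by simp⟩
  · have hpos : 0 < q ^ 2 + b ^ 2 := by positivity
    have ht : √(r / (q ^ 2 + b ^ 2)) ^ 2 = r / (q ^ 2 + b ^ 2) :=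
      Real.sq_sqrt (div_nonneg hr hpos.le)
    refine ⟨√(r / (q ^ 2 + b ^ 2)) * q, -(√(r / (q ^ 2 + b ^ 2)) * b), ?_, ?_⟩
    · rw [neg_sq, mul_pow, mul_pow, ← mul_add, ht, div_mul_cancel₀ _ hpos.ne']
    · linear_combination √(r / (q ^ 2 + b ^ 2)) ^ 2 * q * hpq

/-- Completing the square in `gA`, in terms of the eigenvalues of `A`. -/
theorem gA_eq {ν : ℝ} (hν : ν ≠ 1) {A : Matrix (Fin 2) (Fin 2) ℝ} (hA : A.IsSymm)
    {l₁ l₂ : ℝ} (htr : Matrix.trace A = l₁ + l₂) (hdet : A.det = l₁ * l₂) (ξ : Fin 2 → ℝ) :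
    gA ν A ξ = (l₁ + (ξ 0 ^ 2 + ξ 1 ^ 2) + ν * l₂) ^ 2 / (1 - ν) + (1 + ν) * l₂ ^ 2
      + 2 * ((A 0 0 - l₁) * ξ 0 ^ 2 + 2 * A 0 1 * (ξ 0 * ξ 1) + (A 1 1 - l₁) * ξ 1 ^ 2) := by
  have hsymm : A 1 0 = A 0 1 := hA.apply 0 1
  have hν' : 1 - ν ≠ 0 := sub_ne_zero.2 hν.symm
  rw [gA, htr]
  rw [Matrix.trace_fin_two] at htr
  rw [Matrix.det_fin_two, hsymm] at hdet
  simp only [frobSq, Fin.sum_univ_two, Matrix.add_apply, Matrix.of_apply, hsymm]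
  field_simp
  linear_combination (1 - ν) * (A 0 0 + A 1 1 + l₁ + l₂) * htr - 2 * (1 - ν) * hdet

theorem stmt3 (ν : ℝ) (hν₁ : -1 < ν) (hν₂ : ν < 1 / 2)
    (A : Matrix (Fin 2) (Fin 2) ℝ) (hA : A.IsSymm)
    (l₁ l₂ : ℝ) (hle : l₁ ≤ l₂)
    (htr : Matrix.trace A = l₁ + l₂) (hdet : A.det = l₁ * l₂) :
    ∃ ξ₀ : Fin 2 → ℝ, (∀ ξ : Fin 2 → ℝ, gA ν A ξ₀ ≤ gA ν A ξ) ∧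
      gA ν A ξ₀ = if 0 ≤ ν * l₂ + l₁ then gA ν A 0 else (1 + ν) * l₂ ^ 2 := by
  have hν : 0 < 1 - ν := by linarith
  have hg := gA_eq (by linarith : ν ≠ 1) hA htr hdet
  have hsymm : A 1 0 = A 0 1 := hA.apply 0 1
  rw [Matrix.trace_fin_two] at htr
  rw [Matrix.det_fin_two, hsymm] at hdet
  have hpq : (A 0 0 - l₁) * (A 1 1 - l₁) = A 0 1 ^ 2 := by
    linear_combination hdet - l₁ * htr
  have hp : 0 ≤ A 0 0 - l₁ := by nlinarith [sq_nonneg (A 0 1), sq_nonneg (A 0 0 - l₁)]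
  have hq : 0 ≤ A 1 1 - l₁ := by nlinarith [sq_nonneg (A 0 1), sq_nonneg (A 1 1 - l₁)]
  have hQ (ξ : Fin 2 → ℝ) := degenerate_form_nonneg hp hq hpq (ξ 0) (ξ 1)
  split_ifs with h
  · refine ⟨0, fun ξ => ?_, rfl⟩
    have hsq : (l₁ + ν * l₂) ^ 2 / (1 - ν) ≤
        (l₁ + (ξ 0 ^ 2 + ξ 1 ^ 2) + ν * l₂) ^ 2 / (1 - ν) := by
      gcongr
      · linarith
      · nlinarith [sq_nonneg (ξ 0), sq_nonneg (ξ 1)]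
    have h0 : gA ν A 0 = (l₁ + ν * l₂) ^ 2 / (1 - ν) + (1 + ν) * l₂ ^ 2 := by
      rw [hg]
      simp
    rw [h0, hg ξ]
    linarith [hQ ξ]
  · obtain ⟨x, y, hr, hxy⟩ :=
      exists_isotropic_of_degenerate hpq (by linarith : 0 ≤ -(ν * l₂ + l₁))
    have hmin : gA ν A ![x, y] = (1 + ν) * l₂ ^ 2 := by
      rw [hg]
      simp [hr, hxy]
    refine ⟨![x, y], fun ξ => ?_, hmin⟩
    rw [hmin, hg ξ]
    have : 0 ≤ (l₁ + (ξ 0 ^ 2 + ξ 1 ^ 2) + ν * l₂) ^ 2 / (1 - ν) := by positivity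
    linarith [hQ ξ]
end

section
/- Let ν ∈ (−1, 1/2) and λ₁ ≤ λ₂ be real numbers with ν·λ₂ + λ₁ ≥ 0. Then for all (x, y) ∈ ℝ², g̃(x, y) ≥ g̃(0, 0), where g̃(x,y) = (x²+λ₁)² + (y²+λ₂)² + 2x²y² + (ν/(1−ν))·(λ₁+λ₂+x²+y²)². Moreover, if ν·λ₂ + λ₁ > 0 then the inequality is strict for every (x, y) ≠ (0, 0). -/
/-- g̃(x,y) = (x²+λ₁)² + (y²+λ₂)² + 2x²y² + (ν/(1−ν))·(λ₁+λ₂+x²+y²)². -/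
noncomputable def gtilde (ν l₁ l₂ x y : ℝ) : ℝ :=
  (x ^ 2 + l₁) ^ 2 + (y ^ 2 + l₂) ^ 2 + 2 * x ^ 2 * y ^ 2
    + ν / (1 - ν) * (l₁ + l₂ + x ^ 2 + y ^ 2) ^ 2

theorem gtilde_sub_gtilde_zero {ν : ℝ} (hν : ν < 1) (l₁ l₂ x y : ℝ) :
    gtilde ν l₁ l₂ x y - gtilde ν l₁ l₂ 0 0 =
      ((x ^ 2 + y ^ 2) ^ 2 + 2 * (x ^ 2 + y ^ 2) * (ν * l₂ + l₁)
        + 2 * y ^ 2 * ((1 - ν) * (l₂ - l₁))) / (1 - ν) := by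
  have h : 1 - ν ≠ 0 := by linarith
  unfold gtilde
  field_simp
  ring

theorem gtilde_zero_lt {ν l₁ l₂ : ℝ} (hν : ν < 1) (hle : l₁ ≤ l₂) (hpos : 0 ≤ ν * l₂ + l₁)
    {x y : ℝ} (hxy : (x, y) ≠ ((0 : ℝ), (0 : ℝ))) :
    gtilde ν l₁ l₂ 0 0 < gtilde ν l₁ l₂ x y := by
  have hν' : 0 < 1 - ν := by linarith
  have hl : 0 ≤ l₂ - l₁ := by linarith
  have hr : 0 < x ^ 2 + y ^ 2 := by
    by_cases hx : x = 0
    · have hy : y ≠ 0 := fun hy => hxy (by rw [hx, hy])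
      positivity
    · positivity
  rw [← sub_pos, gtilde_sub_gtilde_zero hν]
  positivity

theorem stmt6 (ν l₁ l₂ : ℝ) (hν₁ : -1 < ν) (hν₂ : ν < 1 / 2) (hle : l₁ ≤ l₂)
    (hpos : 0 ≤ ν * l₂ + l₁) :
    (∀ x y : ℝ, gtilde ν l₁ l₂ 0 0 ≤ gtilde ν l₁ l₂ x y) ∧
      (0 < ν * l₂ + l₁ →
        ∀ x y : ℝ, (x, y) ≠ ((0 : ℝ), (0 : ℝ)) →
          gtilde ν l₁ l₂ 0 0 < gtilde ν l₁ l₂ x y) := by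
  have hν : ν < 1 := by linarith
  refine ⟨fun x y => ?_, fun _ x y hxy => gtilde_zero_lt hν hle hpos hxy⟩
  by_cases hxy : (x, y) = ((0 : ℝ), (0 : ℝ))
  · obtain ⟨rfl, rfl⟩ := Prod.mk.inj hxy
    exact le_rfl
  · exact (gtilde_zero_lt hν hle hpos hxy).le
end

section
/- Let ν ∈ (−1, 1/2) and λ₁ ≤ λ₂ be real numbers with ν·λ₂ + λ₁ < 0. Then for all (x, y) ∈ ℝ², g̃(x, y) ≥ (1+ν)·λ₂², where g̃(x,y) = (x²+λ₁)² + (y²+λ₂)² + 2x²y² + (ν/(1−ν))·(λ₁+λ₂+x²+y²)². -/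
/-- Completing the square in `x² + y² + l₁ + ν l₂`. -/
theorem gtilde_eq_add_sq {ν : ℝ} (hν : ν ≠ 1) (l₁ l₂ x y : ℝ) :
    gtilde ν l₁ l₂ x y = (1 + ν) * l₂ ^ 2 + 2 * y ^ 2 * (l₂ - l₁)
      + (x ^ 2 + y ^ 2 + l₁ + ν * l₂) ^ 2 / (1 - ν) := by
  have h : 1 - ν ≠ 0 := sub_ne_zero.mpr hν.symm
  unfold gtilde
  field_simp
  ring

theorem stmt8 (ν l₁ l₂ : ℝ) (hν₁ : -1 < ν) (hν₂ : ν < 1 / 2) (hle : l₁ ≤ l₂)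
    (hneg : ν * l₂ + l₁ < 0) :
    ∀ x y : ℝ, (1 + ν) * l₂ ^ 2 ≤ gtilde ν l₁ l₂ x y := by
  intro x y
  rw [gtilde_eq_add_sq (show ν < 1 by linarith).ne]
  have h₁ : 0 ≤ 2 * y ^ 2 * (l₂ - l₁) := mul_nonneg (by positivity) (sub_nonneg.mpr hle)
  have h₂ : 0 ≤ (x ^ 2 + y ^ 2 + l₁ + ν * l₂) ^ 2 / (1 - ν) :=
    div_nonneg (sq_nonneg _) (by linarith)
  linarith
end

section
/- Let E > 0, ν ∈ (−1, 1/2), and let A be a real symmetric 2×2 matrix whose eigenvalues λ₁ ≤ λ₂ satisfy ν·λ₂ + λ₁ ≥ 0. Then for every ξ ∈ ℝ², J(A + (1/2)·ξ⊗ξ) ≥ J(A), where J(B) = E/(2(1−ν²))·((Tr B)² − 2(1−ν)·det B). Moreover, if ν·λ₂ + λ₁ > 0, then the inequality is strict for every ξ ≠ 0. -/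
/-- The Föppl–von Kármán energy density on 2×2 matrices. -/
noncomputable def J (E ν : ℝ) (A : Matrix (Fin 2) (Fin 2) ℝ) : ℝ :=
  E / (2 * (1 - ν ^ 2)) * ((Matrix.trace A) ^ 2 - 2 * (1 - ν) * A.det)

/-- A binary quadratic form with nonnegative trace and vanishing discriminant is nonnegative. -/
theorem binary_form_nonneg {p b r : ℝ} (htr : 0 ≤ p + r) (hdet : p * r = b ^ 2) (x y : ℝ) :
    0 ≤ p * x ^ 2 + 2 * b * x * y + r * y ^ 2 := by
  have hmul : (p + r) * (p * x ^ 2 + 2 * b * x * y + r * y ^ 2) =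
      (p * x + b * y) ^ 2 + (b * x + r * y) ^ 2 := by
    linear_combination (x ^ 2 + y ^ 2) * hdet
  rcases htr.eq_or_lt with h | h
  · obtain rfl : r = -p := by linarith
    have hp : p = 0 := by nlinarith [sq_nonneg p, sq_nonneg b]
    have hb : b = 0 := by nlinarith [sq_nonneg p, sq_nonneg b]
    simp [hp, hb]
  · exact nonneg_of_mul_nonneg_right (hmul ▸ by positivity) h

/-- The quadratic form of a symmetric matrix with eigenvalues `l₁ ≤ l₂` is bounded below by
`l₁ * |ξ|²`. -/
theorem smallest_eigenvalue_mul_le {a b c l₁ l₂ : ℝ} (hle : l₁ ≤ l₂) (htr : a + c = l₁ + l₂)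
    (hdet : a * c - b * b = l₁ * l₂) (x y : ℝ) :
    l₁ * (x ^ 2 + y ^ 2) ≤ a * x ^ 2 + 2 * b * x * y + c * y ^ 2 := by
  have h := binary_form_nonneg (p := a - l₁) (b := b) (r := c - l₁) (by linarith)
    (by linear_combination hdet - l₁ * htr) x y
  linarith

/-- The energy gained by adding a rank-one term to the strain. -/
theorem J_add_sub (E ν : ℝ) (A : Matrix (Fin 2) (Fin 2) ℝ) (hA : A.IsSymm) (ξ : Fin 2 → ℝ) :
    J E ν (A + (1 / 2 : ℝ) • Matrix.of fun i j => ξ i * ξ j) - J E ν A =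
      E / (2 * (1 - ν ^ 2)) *
        ((ξ 0 ^ 2 + ξ 1 ^ 2) ^ 2 / 4 + ν * (A 0 0 + A 1 1) * (ξ 0 ^ 2 + ξ 1 ^ 2) +
          (1 - ν) * (A 0 0 * ξ 0 ^ 2 + 2 * A 0 1 * ξ 0 * ξ 1 + A 1 1 * ξ 1 ^ 2)) := by
  have h : A 1 0 = A 0 1 := hA.apply 0 1
  simp only [J, Matrix.trace_fin_two, Matrix.det_fin_two, Matrix.add_apply, Matrix.smul_apply,
    Matrix.of_apply, smul_eq_mul, h]
  ring

/-- The rank-one energy gain is bounded below in terms of the smallest stress eigenvalue. -/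
theorem le_J_add_sub {E ν : ℝ} (hE : 0 < E) (hν₁ : -1 < ν) (hν₂ : ν < 1)
    {A : Matrix (Fin 2) (Fin 2) ℝ} (hA : A.IsSymm) {l₁ l₂ : ℝ} (hle : l₁ ≤ l₂)
    (htr : Matrix.trace A = l₁ + l₂) (hdet : A.det = l₁ * l₂) (ξ : Fin 2 → ℝ) :
    E / (2 * (1 - ν ^ 2)) *
        ((ξ 0 ^ 2 + ξ 1 ^ 2) ^ 2 / 4 + (ν * l₂ + l₁) * (ξ 0 ^ 2 + ξ 1 ^ 2)) ≤
      J E ν (A + (1 / 2 : ℝ) • Matrix.of fun i j => ξ i * ξ j) - J E ν A := by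
  have hν : 0 < 1 - ν ^ 2 := by nlinarith
  rw [Matrix.trace_fin_two] at htr
  rw [Matrix.det_fin_two, hA.apply 0 1] at hdet
  have hq := mul_le_mul_of_nonneg_left
    (smallest_eigenvalue_mul_le hle htr hdet (ξ 0) (ξ 1)) (sub_nonneg.2 hν₂.le)
  rw [J_add_sub E ν A hA ξ, htr]
  refine mul_le_mul_of_nonneg_left ?_ (by positivity)
  linarith

theorem stmt11 (E ν : ℝ) (hE : 0 < E) (hν₁ : -1 < ν) (hν₂ : ν < 1 / 2)
    (A : Matrix (Fin 2) (Fin 2) ℝ) (hA : A.IsSymm)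
    (l₁ l₂ : ℝ) (hle : l₁ ≤ l₂)
    (htr : Matrix.trace A = l₁ + l₂) (hdet : A.det = l₁ * l₂)
    (hpos : 0 ≤ ν * l₂ + l₁) :
    (∀ ξ : Fin 2 → ℝ,
        J E ν A ≤ J E ν (A + (1 / 2 : ℝ) • Matrix.of fun i j => ξ i * ξ j)) ∧
      (0 < ν * l₂ + l₁ → ∀ ξ : Fin 2 → ℝ, ξ ≠ 0 →
        J E ν A < J E ν (A + (1 / 2 : ℝ) • Matrix.of fun i j => ξ i * ξ j)) := by
  have hν : 0 < 1 - ν ^ 2 := by nlinarith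
  have key := le_J_add_sub hE hν₁ (by linarith) hA hle htr hdet
  refine ⟨fun ξ => sub_nonneg.1 (le_trans (by positivity) (key ξ)),
    fun hlt ξ hξ => sub_pos.1 (lt_of_lt_of_le ?_ (key ξ))⟩
  have hs : 0 < ξ 0 ^ 2 + ξ 1 ^ 2 := by
    refine lt_of_le_of_ne (by positivity) fun h => hξ ?_
    have h0 : ξ 0 = 0 := by nlinarith [sq_nonneg (ξ 0), sq_nonneg (ξ 1)]
    have h1 : ξ 1 = 0 := by nlinarith [sq_nonneg (ξ 0), sq_nonneg (ξ 1)]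
    ext i
    fin_cases i <;> assumption
  positivity
end

section
/- Let Ω = (−2,2)×(−1,1) ⊂ ℝ², E > 0, ν ∈ (−1, 1/2), h > 0, and let f be a real constant. For n ∈ ℕ define uₙ(x₁,x₂) = (−(n/6)(2+x₁)³, 0) and wₙ(x₁,x₂) = (√n/2)(2+x₁)². Then: (i) 𝔼(uₙ) + (1/2)·Dwₙ ⊗ Dwₙ = 0 at every point of Ω; (ii) wₙ vanishes on the segment {−2}×[−1,1]; (iii) the energy value h·∫_Ω J(𝔼(uₙ) + (1/2)·Dwₙ⊗Dwₙ) dx + (h³/12)·∫_Ω J(D²wₙ) dx − h·f·∫_Ω div uₙ dx equals (n·h/3)·(h²·E/(1−ν²) + 64·f); in particular, if f < −h²·E/(64·(1−ν²)), this energy tends to −∞ as n → ∞. -/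
open MeasureTheory

/-- Symmetrized gradient 𝔼(u) of the in-plane displacement u = (u1, u2). -/
noncomputable def strain (u1 u2 : ℝ × ℝ → ℝ) (x : ℝ × ℝ) : Matrix (Fin 2) (Fin 2) ℝ :=
  !![pd1 u1 x, (pd2 u1 x + pd1 u2 x) / 2;
     (pd2 u1 x + pd1 u2 x) / 2, pd2 u2 x]

/-- The tensor Dw ⊗ Dw of the out-of-plane displacement w. -/
noncomputable def gradTensor (w : ℝ × ℝ → ℝ) (x : ℝ × ℝ) : Matrix (Fin 2) (Fin 2) ℝ :=
  !![pd1 w x * pd1 w x, pd1 w x * pd2 w x;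
     pd2 w x * pd1 w x, pd2 w x * pd2 w x]

/-- The Hessian matrix D²w. -/
noncomputable def hess (w : ℝ × ℝ → ℝ) (x : ℝ × ℝ) : Matrix (Fin 2) (Fin 2) ℝ :=
  !![pd1 (pd1 w) x, pd2 (pd1 w) x;
     pd1 (pd2 w) x, pd2 (pd2 w) x]

/-- The first partial derivative of a function of the first coordinate alone. -/
theorem pd1_comp_fst {g : ℝ → ℝ} {g' : ℝ} {x : ℝ × ℝ} (hg : HasDerivAt g g' x.1) :
    pd1 (fun y => g y.1) x = g' := by
  have h : HasFDerivAt (fun y : ℝ × ℝ => g y.1) (g' • ContinuousLinearMap.fst ℝ ℝ ℝ) x :=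
    hg.comp_hasFDerivAt x hasFDerivAt_fst
  simp [pd1, h.fderiv]

/-- The second partial derivative of a function of the first coordinate alone vanishes. -/
theorem pd2_comp_fst {g : ℝ → ℝ} {g' : ℝ} {x : ℝ × ℝ} (hg : HasDerivAt g g' x.1) :
    pd2 (fun y => g y.1) x = 0 := by
  have h : HasFDerivAt (fun y : ℝ × ℝ => g y.1) (g' • ContinuousLinearMap.fst ℝ ℝ ℝ) x :=
    hg.comp_hasFDerivAt x hasFDerivAt_fst
  simp [pd2, h.fderiv]

/-- The integral over a rectangle of a function of the first coordinate alone. -/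
theorem setIntegral_Ioo_prod_comp_fst {a b c d : ℝ} (hab : a ≤ b) (hcd : c ≤ d) (g : ℝ → ℝ) :
    ∫ x in Set.Ioo a b ×ˢ Set.Ioo c d, g x.1 = (d - c) * ∫ t in a..b, g t := by
  have h := setIntegral_prod_mul (μ := (volume : Measure ℝ)) (ν := (volume : Measure ℝ))
    g (fun _ => (1 : ℝ)) (Set.Ioo a b) (Set.Ioo c d)
  rw [← Measure.volume_eq_prod] at h
  simp only [mul_one] at h
  rw [h, intervalIntegral.integral_of_le hab, integral_Ioc_eq_integral_Ioo]
  simp [hcd, mul_comm]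

/-- The derivative of `c * (2 + s) ^ k` with respect to `s`. -/
theorem hasDerivAt_const_mul_two_add_pow (c : ℝ) (k : ℕ) (t : ℝ) :
    HasDerivAt (fun s : ℝ => c * (2 + s) ^ k) (c * (k * (2 + t) ^ (k - 1))) t := by
  simpa using (((hasDerivAt_id t).const_add 2).pow k).const_mul c

theorem stmt12 (E ν h f : ℝ) (hE : 0 < E) (hν₁ : -1 < ν) (hν₂ : ν < 1 / 2)
    (hh : 0 < h)
    (Ω : Set (ℝ × ℝ)) (hΩ : Ω = Set.Ioo (-2 : ℝ) 2 ×ˢ Set.Ioo (-1 : ℝ) 1)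
    (u1 u2 w : ℕ → ℝ × ℝ → ℝ)
    (hu1 : ∀ (n : ℕ) (x : ℝ × ℝ), u1 n x = -((n : ℝ) / 6) * (2 + x.1) ^ 3)
    (hu2 : ∀ (n : ℕ) (x : ℝ × ℝ), u2 n x = 0)
    (hw : ∀ (n : ℕ) (x : ℝ × ℝ), w n x = (Real.sqrt n / 2) * (2 + x.1) ^ 2) :
    -- (i) 𝔼(uₙ) + (1/2)·Dwₙ ⊗ Dwₙ = 0 on Ω
    (∀ n : ℕ, ∀ x ∈ Ω,
        strain (u1 n) (u2 n) x + (1 / 2 : ℝ) • gradTensor (w n) x = 0) ∧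
    -- (ii) wₙ vanishes on {−2} × [−1,1]
    (∀ n : ℕ, ∀ x : ℝ × ℝ, x.1 = -2 → x.2 ∈ Set.Icc (-1 : ℝ) 1 → w n x = 0) ∧
    -- (iii) the energy value
    (∀ n : ℕ,
        h * (∫ x in Ω, J E ν (strain (u1 n) (u2 n) x + (1 / 2 : ℝ) • gradTensor (w n) x))
          + h ^ 3 / 12 * (∫ x in Ω, J E ν (hess (w n) x))
          - h * f * (∫ x in Ω, (pd1 (u1 n) x + pd2 (u2 n) x))
        = (n : ℝ) * h / 3 * (h ^ 2 * E / (1 - ν ^ 2) + 64 * f)) ∧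
    -- in particular, for f sufficiently negative the energy tends to −∞
    (f < -h ^ 2 * E / (64 * (1 - ν ^ 2)) →
      Filter.Tendsto (fun n : ℕ =>
          h * (∫ x in Ω, J E ν (strain (u1 n) (u2 n) x + (1 / 2 : ℝ) • gradTensor (w n) x))
            + h ^ 3 / 12 * (∫ x in Ω, J E ν (hess (w n) x))
            - h * f * (∫ x in Ω, (pd1 (u1 n) x + pd2 (u2 n) x)))
        Filter.atTop Filter.atBot) := by
  have eu1 (n : ℕ) : u1 n = fun x => -((n : ℝ) / 6) * (2 + x.1) ^ 3 := funext (hu1 n)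
  have eu2 (n : ℕ) : u2 n = fun _ => 0 := funext (hu2 n)
  have ew (n : ℕ) : w n = fun x => Real.sqrt n / 2 * (2 + x.1) ^ 2 := funext (hw n)
  have pd1u1 (n : ℕ) (x : ℝ × ℝ) : pd1 (u1 n) x = -((n : ℝ) / 2) * (2 + x.1) ^ 2 := by
    rw [eu1, pd1_comp_fst (hasDerivAt_const_mul_two_add_pow _ 3 x.1)]
    push_cast
    ring
  have pd2u1 (n : ℕ) (x : ℝ × ℝ) : pd2 (u1 n) x = 0 := by
    rw [eu1, pd2_comp_fst (hasDerivAt_const_mul_two_add_pow _ 3 x.1)]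
  have pd1u2 (n : ℕ) (x : ℝ × ℝ) : pd1 (u2 n) x = 0 := by simp [eu2, pd1]
  have pd2u2 (n : ℕ) (x : ℝ × ℝ) : pd2 (u2 n) x = 0 := by simp [eu2, pd2]
  have pd1w (n : ℕ) : pd1 (w n) = fun x => Real.sqrt n * (2 + x.1) ^ 1 := by
    funext x
    rw [ew, pd1_comp_fst (hasDerivAt_const_mul_two_add_pow _ 2 x.1)]
    push_cast
    ring
  have pd2w (n : ℕ) : pd2 (w n) = fun _ => 0 := by
    funext x
    rw [ew, pd2_comp_fst (hasDerivAt_const_mul_two_add_pow _ 2 x.1)]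
  have hmembrane (n : ℕ) (x : ℝ × ℝ) :
      strain (u1 n) (u2 n) x + (1 / 2 : ℝ) • gradTensor (w n) x = 0 := by
    have hs : Real.sqrt n * Real.sqrt n = n := Real.mul_self_sqrt n.cast_nonneg
    ext i j
    fin_cases i <;> fin_cases j <;>
      simp [strain, gradTensor, pd1u1, pd2u1, pd1u2, pd2u2, pd1w, pd2w]
    linear_combination (2 + x.1) ^ 2 / 2 * hs
  have hbending (n : ℕ) (x : ℝ × ℝ) : J E ν (hess (w n) x) = E / (2 * (1 - ν ^ 2)) * n := by
    have h11 : pd1 (pd1 (w n)) x = Real.sqrt n := by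
      rw [pd1w, pd1_comp_fst (hasDerivAt_const_mul_two_add_pow _ 1 x.1)]
      simp
    have h21 : pd2 (pd1 (w n)) x = 0 := by
      rw [pd1w, pd2_comp_fst (hasDerivAt_const_mul_two_add_pow _ 1 x.1)]
    have h12 : pd1 (pd2 (w n)) x = 0 := by simp [pd2w, pd1]
    have h22 : pd2 (pd2 (w n)) x = 0 := by
      rw [pd2w]
      simp [pd2]
    simp [J, hess, h11, h21, h12, h22, Matrix.trace_fin_two, Matrix.det_fin_two]
  have hν : 0 < 1 - ν ^ 2 := by nlinarith
  have henergy (n : ℕ) :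
      h * (∫ x in Ω, J E ν (strain (u1 n) (u2 n) x + (1 / 2 : ℝ) • gradTensor (w n) x))
          + h ^ 3 / 12 * (∫ x in Ω, J E ν (hess (w n) x))
          - h * f * (∫ x in Ω, (pd1 (u1 n) x + pd2 (u2 n) x))
        = (n : ℝ) * h / 3 * (h ^ 2 * E / (1 - ν ^ 2) + 64 * f) := by
    have hJ0 : J E ν 0 = 0 := by simp [J]
    have hsq : ∫ t in (-2 : ℝ)..2, (2 + t) ^ 2 = 64 / 3 := by
      rw [intervalIntegral.integral_comp_add_left (fun t : ℝ => t ^ 2) 2, integral_pow]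
      norm_num
    simp only [hmembrane, hJ0, hbending, pd1u1, pd2u2, add_zero]
    rw [hΩ, setIntegral_Ioo_prod_comp_fst (by norm_num) (by norm_num)
        (fun _ => E / (2 * (1 - ν ^ 2)) * n),
      setIntegral_Ioo_prod_comp_fst (by norm_num) (by norm_num)
        (fun t => -((n : ℝ) / 2) * (2 + t) ^ 2),
      intervalIntegral.integral_const, intervalIntegral.integral_const_mul, hsq,
      integral_zero, smul_eq_mul]
    field_simp
    ring
  refine ⟨fun n x _ => hmembrane n x, fun n x hx _ => by simp [hw, hx], henergy, fun hf => ?_⟩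
  have hneg : h ^ 2 * E / (1 - ν ^ 2) + 64 * f < 0 := by
    rw [lt_div_iff₀ (by positivity)] at hf
    rw [div_add' _ _ _ hν.ne', div_lt_iff₀ hν]
    linarith
  simp only [henergy]
  exact ((tendsto_natCast_atTop_atTop.atTop_mul_const hh).atTop_div_const
    (by norm_num)).atTop_mul_const_of_neg hneg
end

section
/- Let ψ : ℝ → ℝ be a C¹ function. Define F(t) = (1/2)·∫_{−1}^{t} |ψ'(s)|² ds, and on ℝ² set φ(x₁,x₂) = ψ(x₁−x₂) and u(x₁,x₂) = (−F(x₁−x₂), F(x₁−x₂)). Then at every point of ℝ², 2·𝔼(u) + Dφ ⊗ Dφ = 0, where 𝔼(u) = (Du + Duᵀ)/2. -/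
theorem HasDerivAt.hasFDerivAt_comp_fst_sub_snd {g : ℝ → ℝ} {g' : ℝ} {x : ℝ × ℝ}
    (hg : HasDerivAt g g' (x.1 - x.2)) :
    HasFDerivAt (fun y : ℝ × ℝ => g (y.1 - y.2))
      (g' • (ContinuousLinearMap.fst ℝ ℝ ℝ - ContinuousLinearMap.snd ℝ ℝ ℝ)) x :=
  hg.comp_hasFDerivAt x (hasFDerivAt_fst.sub hasFDerivAt_snd)

theorem pd1_comp_fst_sub_snd {g : ℝ → ℝ} {g' : ℝ} {x : ℝ × ℝ}
    (hg : HasDerivAt g g' (x.1 - x.2)) : pd1 (fun y => g (y.1 - y.2)) x = g' := by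
  simp [pd1, hg.hasFDerivAt_comp_fst_sub_snd.fderiv]

theorem pd2_comp_fst_sub_snd {g : ℝ → ℝ} {g' : ℝ} {x : ℝ × ℝ}
    (hg : HasDerivAt g g' (x.1 - x.2)) : pd2 (fun y => g (y.1 - y.2)) x = -g' := by
  simp [pd2, hg.hasFDerivAt_comp_fst_sub_snd.fderiv]

theorem stmt14 (ψ : ℝ → ℝ) (hψ : ContDiff ℝ 1 ψ)
    (F : ℝ → ℝ) (hF : ∀ t : ℝ, F t = (1 / 2) * ∫ s in (-1 : ℝ)..t, (deriv ψ s) ^ 2)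
    (φ u1 u2 : ℝ × ℝ → ℝ)
    (hφ : ∀ x : ℝ × ℝ, φ x = ψ (x.1 - x.2))
    (hu1 : ∀ x : ℝ × ℝ, u1 x = -F (x.1 - x.2))
    (hu2 : ∀ x : ℝ × ℝ, u2 x = F (x.1 - x.2)) :
    ∀ x : ℝ × ℝ, (2 : ℝ) • strain u1 u2 x + gradTensor φ x = 0 := by
  intro x
  obtain rfl : φ = fun y => ψ (y.1 - y.2) := funext hφ
  obtain rfl : u1 = fun y => (-F) (y.1 - y.2) := funext hu1
  obtain rfl : u2 = fun y => F (y.1 - y.2) := funext hu2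
  have hψ' : HasDerivAt ψ (deriv ψ (x.1 - x.2)) (x.1 - x.2) :=
    (hψ.differentiable one_ne_zero _).hasDerivAt
  have hcont : Continuous fun s => deriv ψ s ^ 2 := (hψ.continuous_deriv le_rfl).pow 2
  have hF' : HasDerivAt F (1 / 2 * deriv ψ (x.1 - x.2) ^ 2) (x.1 - x.2) := by
    rw [funext hF]
    exact (hcont.integral_hasStrictDerivAt (-1) _).hasDerivAt.const_mul (1 / 2)
  rw [strain, gradTensor, pd1_comp_fst_sub_snd hψ', pd2_comp_fst_sub_snd hψ',
    pd1_comp_fst_sub_snd hF', pd2_comp_fst_sub_snd hF',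
    pd1_comp_fst_sub_snd hF'.neg, pd2_comp_fst_sub_snd hF'.neg]
  ext i j
  fin_cases i <;> fin_cases j <;> simp <;> ring
end
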